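/- Let n ≥ 2 be an integer, Q ∈ ℝ, a ∈ ℝ, and f : [a,∞) → ℝ a smooth positive function satisfying f''(s) ≤ ((n−1)/(2 f(s)))(1 − f'(s)² − Q²/f(s)^(2(n−1))) for all s ≥ a. Let s₀ > a with f'(s₀) > 0. Then there exist δ ∈ (0, s₀ − a) and a smooth positive function f̃ : [s₀ − δ, ∞) → ℝ such that f̃ = f on [s₀, ∞) and f̃''(s) < ((n−1)/(2 f̃(s)))(1 − f̃'(s)² − Q²/f̃(s)^(2(n−1))) for all s ∈ [s₀ − δ, s₀). Moreover, if in addition α > 0 is a constant with f(s₀) > α and f''(s₀) > 0, then δ and f̃ can be chosen so that also f̃(s₀ − δ) > α and f̃'(s₀ − δ) < f'(s₀). -/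

import Mathlib

open Filter Topology Set

lemma egn_hasDerivAt {t : ℝ} (ht : 0 < t) :
    HasDerivAt expNegInvGlue (expNegInvGlue t * (1 / t ^ 2)) t := by
  have h1 : HasDerivAt (fun x : ℝ => Real.exp (-x⁻¹)) (Real.exp (-t⁻¹) * (1 / t ^ 2)) t := by
    have := ((hasDerivAt_inv ht.ne').fun_neg).exp
    convert this using 1
    simp
  have h2 : expNegInvGlue t = Real.exp (-t⁻¹) := by simp [expNegInvGlue, not_le.mpr ht]
  rw [h2]
  refine h1.congr_of_eventuallyEq ?_
  filter_upwards [lt_mem_nhds ht] with x hx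
  simp [expNegInvGlue, not_le.mpr hx]

lemma egn_deriv {t : ℝ} (ht : 0 < t) :
    deriv expNegInvGlue t = expNegInvGlue t * (1 / t ^ 2) := (egn_hasDerivAt ht).deriv

lemma egn_deriv2 {t : ℝ} (ht : 0 < t) :
    deriv (deriv expNegInvGlue) t = expNegInvGlue t * (1 / t ^ 4 - 2 / t ^ 3) := by
  have h1 : deriv expNegInvGlue =ᶠ[𝓝 t] fun x => expNegInvGlue x * (x ^ 2)⁻¹ := by
    filter_upwards [lt_mem_nhds ht] with x hx
    rw [egn_deriv hx, one_div]
  rw [h1.deriv_eq]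
  have h2 : HasDerivAt (fun x : ℝ => (x ^ 2)⁻¹) (-(2 * t) / (t ^ 2) ^ 2) t := by
    have := (hasDerivAt_pow 2 t).fun_inv (by positivity)
    simpa using this
  have := ((egn_hasDerivAt ht).fun_mul h2).deriv
  rw [this]
  field_simp
  ring

lemma egn_deriv_nonpos {t : ℝ} (ht : t < 0) :
    expNegInvGlue =ᶠ[𝓝 t] fun _ => (0 : ℝ) := by
  filter_upwards [gt_mem_nhds ht] with x hx
  exact expNegInvGlue.zero_of_nonpos hx.le

lemma egn_smooth1 : ContDiff ℝ 1 (deriv expNegInvGlue) := by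
  have h : ContDiff ℝ 2 expNegInvGlue := expNegInvGlue.contDiff
  exact ((contDiff_succ_iff_deriv (n := 1)).1 (by simpa [one_add_one_eq_two] using h)).2.2

lemma egn_zero_of_neg {F : ℝ → ℝ} (hF : Continuous F) (h : ∀ t < 0, F t = 0) : F 0 = 0 := by
  have h1 : Tendsto F (𝓝[<] 0) (𝓝 (F 0)) := hF.continuousAt.tendsto.mono_left nhdsWithin_le_nhds
  have h2 : Tendsto F (𝓝[<] 0) (𝓝 0) := by
    refine tendsto_const_nhds.congr' ?_
    filter_upwards [self_mem_nhdsWithin] with t ht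
    exact (h t ht).symm
  exact tendsto_nhds_unique h1 h2

lemma egn_d1_zero : deriv expNegInvGlue 0 = 0 :=
  egn_zero_of_neg egn_smooth1.continuous fun t ht => by
    rw [(egn_deriv_nonpos ht).deriv_eq]; simp

lemma egn_d2_cont : Continuous (deriv (deriv expNegInvGlue)) :=
  egn_smooth1.continuous_deriv le_rfl

lemma egn_d2_zero : deriv (deriv expNegInvGlue) 0 = 0 :=
  egn_zero_of_neg egn_d2_cont fun t ht => by
    rw [(egn_deriv_nonpos ht).deriv.deriv_eq]; simp

lemma egn_dom (K : ℝ) : ∀ᶠ t in 𝓝[>] (0 : ℝ),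
    0 < deriv expNegInvGlue t ∧
    K * (expNegInvGlue t + deriv expNegInvGlue t) < deriv (deriv expNegInvGlue) t := by
  have h : ContinuousAt (fun t : ℝ => 1 - 2 * t - K * (t ^ 4 + t ^ 2)) 0 := by fun_prop
  have h0 : ∀ᶠ t in 𝓝 (0 : ℝ), 0 < 1 - 2 * t - K * (t ^ 4 + t ^ 2) :=
    h.eventually (lt_mem_nhds (by simp))
  filter_upwards [h0.filter_mono nhdsWithin_le_nhds, self_mem_nhdsWithin] with t h1 ht
  have ht : 0 < t := ht
  have hg := expNegInvGlue.pos_of_pos ht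
  rw [egn_deriv ht, egn_deriv2 ht]
  refine ⟨by positivity, ?_⟩
  have : expNegInvGlue t * (1 / t ^ 4 - 2 / t ^ 3)
      - K * (expNegInvGlue t + expNegInvGlue t * (1 / t ^ 2))
      = expNegInvGlue t / t ^ 4 * (1 - 2 * t - K * (t ^ 4 + t ^ 2)) := by
    field_simp
  have h2 : 0 < expNegInvGlue t / t ^ 4 * (1 - 2 * t - K * (t ^ 4 + t ^ 2)) := by positivity
  linarith

lemma bend_core (n : ℕ) (Q a : ℝ) (f : ℝ → ℝ)
    (hf : ContDiffOn ℝ (⊤ : ℕ∞) f (Set.Ici a))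
    (hpos : ∀ s ∈ Set.Ici a, 0 < f s)
    (hDEC : ∀ s ∈ Set.Ici a,
      deriv (deriv f) s ≤
        (((n : ℝ) - 1) / (2 * f s)) *
          (1 - (deriv f s) ^ 2 - Q ^ 2 / (f s) ^ (2 * (n - 1))))
    (s₀ : ℝ) (hs₀ : a < s₀) (P : (ℝ → ℝ) → ℝ → Prop)
    (hP : ∀ ft : ℝ → ℝ, ft s₀ = f s₀ → deriv ft s₀ = deriv f s₀ →
      deriv (deriv ft) s₀ = deriv (deriv f) s₀ → ContinuousAt ft s₀ →
      DifferentiableAt ℝ (deriv ft) s₀ → ∀ᶠ s in 𝓝[<] s₀, P ft s) :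
    ∃ δ ∈ Set.Ioo 0 (s₀ - a), ∃ ft : ℝ → ℝ,
      ContDiffOn ℝ (⊤ : ℕ∞) ft (Set.Ici (s₀ - δ)) ∧
      (∀ s ∈ Set.Ici (s₀ - δ), 0 < ft s) ∧
      (∀ s ∈ Set.Ici s₀, ft s = f s) ∧
      (∀ s ∈ Set.Ico (s₀ - δ) s₀,
        deriv (deriv ft) s <
          (((n : ℝ) - 1) / (2 * ft s)) *
            (1 - (deriv ft s) ^ 2 - Q ^ 2 / (ft s) ^ (2 * (n - 1)))) ∧
      P ft (s₀ - δ) := by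
  have hfo : ContDiffOn ℝ (⊤ : ℕ∞) f (Ioi a) := hf.mono Ioi_subset_Ici_self
  have hfd : ContDiffOn ℝ (⊤ : ℕ∞) (deriv f) (Ioi a) :=
    ((contDiffOn_infty_iff_deriv_of_isOpen isOpen_Ioi).1 hfo).2
  have hd1 : ∀ s, a < s → DifferentiableAt ℝ f s := fun s hs =>
    (hfo.differentiableOn (by simp)).differentiableAt (Ioi_mem_nhds hs)
  have hd2 : ∀ s, a < s → DifferentiableAt ℝ (deriv f) s := fun s hs =>
    (hfd.differentiableOn (by simp)).differentiableAt (Ioi_mem_nhds hs)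
  have hgd : Differentiable ℝ expNegInvGlue :=
    (expNegInvGlue.contDiff (n := 1)).differentiable (by simp)
  have hgd2 : Differentiable ℝ (deriv expNegInvGlue) := egn_smooth1.differentiable (by simp)
  set ft : ℝ → ℝ := fun s => f s - expNegInvGlue (s₀ - s) with hft
  have e1 : ∀ s, a < s → deriv ft s = deriv f s + deriv expNegInvGlue (s₀ - s) := by
    intro s hs
    have := (hgd (s₀ - s)).hasDerivAt.comp_const_sub s₀ s
    have := ((hd1 s hs).hasDerivAt.fun_sub this).deriv
    simpa [hft] using this
  have e2a : ∀ s, a < s → HasDerivAt (deriv ft)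
      (deriv (deriv f) s - deriv (deriv expNegInvGlue) (s₀ - s)) s := by
    intro s hs
    have := (hgd2 (s₀ - s)).hasDerivAt.comp_const_sub s₀ s
    have := ((hd2 s hs).hasDerivAt.add this)
    rw [← sub_eq_add_neg] at this
    refine this.congr_of_eventuallyEq ?_
    filter_upwards [Ioi_mem_nhds hs] with x hx
    simpa using e1 x hx
  have e2 := fun s hs => (e2a s hs).deriv
  have z0 : expNegInvGlue 0 = 0 := expNegInvGlue.zero
  have ft0 : ft s₀ = f s₀ := by simp [hft, z0]
  have ft1 : deriv ft s₀ = deriv f s₀ := by simp [e1 s₀ hs₀, egn_d1_zero]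
  have ft2 : deriv (deriv ft) s₀ = deriv (deriv f) s₀ := by simp [e2 s₀ hs₀, egn_d2_zero]
  have c0 : ContinuousAt ft s₀ := by
    refine (hd1 s₀ hs₀).continuousAt.sub ?_
    exact (hgd.continuous.comp (continuous_const.sub continuous_id)).continuousAt
  have c1 : ContinuousAt (deriv ft) s₀ := (e2a s₀ hs₀).continuousAt
  have hp0 : 0 < f s₀ := hpos s₀ hs₀.le
  let G : ℝ × ℝ → ℝ := fun p => (((n : ℝ) - 1) / (2 * p.1)) *
          (1 - p.2 ^ 2 - Q ^ 2 / p.1 ^ (2 * (n - 1)))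
  have hG : ContDiffAt ℝ 1 G (f s₀, deriv f s₀) := by
    have hx : ContDiffAt ℝ 1 (fun p : ℝ × ℝ => p.1) (f s₀, deriv f s₀) := contDiffAt_fst
    have hy : ContDiffAt ℝ 1 (fun p : ℝ × ℝ => p.2) (f s₀, deriv f s₀) := contDiffAt_snd
    refine ContDiffAt.mul (contDiffAt_const.div (contDiffAt_const.mul hx) ?_)
      ((contDiffAt_const.sub (hy.pow 2)).sub (contDiffAt_const.div (hx.pow _) ?_))
    · simpa using hp0.ne'
    · exact pow_ne_zero _ hp0.ne'
  obtain ⟨K, t, ht, hK⟩ := hG.exists_lipschitzOnWith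
  have m1 : ∀ᶠ s in 𝓝 s₀, (f s, deriv f s) ∈ t :=
    ((hd1 s₀ hs₀).continuousAt.prodMk (hd2 s₀ hs₀).continuousAt).eventually_mem ht
  have m2 : ∀ᶠ s in 𝓝 s₀, (ft s, deriv ft s) ∈ t :=
    (c0.prodMk c1).eventually_mem (by rw [ft0, ft1]; exact ht)
  have m3 : ∀ᶠ s in 𝓝 s₀, 0 < ft s := c0.eventually (lt_mem_nhds (by rw [ft0]; exact hp0))
  have m4 : ∀ᶠ s in 𝓝[<] s₀, 0 < deriv expNegInvGlue (s₀ - s) ∧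
      K * (expNegInvGlue (s₀ - s) + deriv expNegInvGlue (s₀ - s))
        < deriv (deriv expNegInvGlue) (s₀ - s) := by
    have : Tendsto (fun s => s₀ - s) (𝓝[<] s₀) (𝓝[>] 0) := by
      refine tendsto_nhdsWithin_iff.2 ⟨?_, ?_⟩
      · have : Continuous fun s => s₀ - s := by fun_prop
        have := this.tendsto s₀
        rw [sub_self] at this
        exact this.mono_left nhdsWithin_le_nhds
      · filter_upwards [self_mem_nhdsWithin] with s hs
        exact mem_Ioi.2 (sub_pos.2 (mem_Iio.1 hs))
    exact this.eventually (egn_dom K)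
  have m5 := hP ft ft0 ft1 ft2 c0 (e2a s₀ hs₀).differentiableAt
  have main : ∀ᶠ s in 𝓝[<] s₀, a < s ∧ 0 < ft s ∧ P ft s ∧
      deriv (deriv ft) s < (((n : ℝ) - 1) / (2 * ft s)) *
            (1 - (deriv ft s) ^ 2 - Q ^ 2 / (ft s) ^ (2 * (n - 1))) := by
    filter_upwards [m1.filter_mono nhdsWithin_le_nhds, m2.filter_mono nhdsWithin_le_nhds,
      m3.filter_mono nhdsWithin_le_nhds, m4, m5,
      (Ioi_mem_nhds hs₀ : Ioi a ∈ 𝓝 s₀) |> mem_nhdsWithin_of_mem_nhds] with s h1 h2 h3 h4 h5 h6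
    refine ⟨h6, h3, h5, ?_⟩
    have hD : deriv (deriv f) s ≤ G (f s, deriv f s) := hDEC s (mem_Ici.2 (le_of_lt (mem_Ioi.1 h6)))
    change _ < G (ft s, deriv ft s)
    have hL := hK.dist_le_mul _ h1 _ h2
    have hdist : dist (f s, deriv f s) (ft s, deriv ft s) ≤
        expNegInvGlue (s₀ - s) + deriv expNegInvGlue (s₀ - s) := by
      have q := expNegInvGlue.nonneg (s₀ - s)
      have q' := h4.1
      rw [Prod.dist_eq, e1 s h6]
      refine max_le ?_ ?_
      · simp only [hft, Real.dist_eq, sub_sub_cancel, abs_of_nonneg q]; linarith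
      · simp only [Real.dist_eq, sub_add_cancel_left, abs_neg, abs_of_pos q']; linarith
    have hL2 := hL.trans (mul_le_mul_of_nonneg_left hdist K.2)
    rw [Real.dist_eq] at hL2
    have hL3 := (le_abs_self _).trans hL2
    rw [e2 s h6]
    have := h4.2
    change _ ≤ (K : ℝ) * _ at hL3
    linarith
  obtain ⟨l, hl, hsub⟩ := mem_nhdsLT_iff_exists_Ico_subset.1 main
  have hl : l < s₀ := hl
  have hl' := hsub (left_mem_Ico.2 hl)
  have hfteq : ∀ s ∈ Ici s₀, ft s = f s := fun s hs => by
    simp [hft, expNegInvGlue.zero_of_nonpos (sub_nonpos.2 hs)]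
  refine ⟨s₀ - l, ⟨by linarith, by linarith [hl'.1]⟩, ft, ?_⟩
  rw [sub_sub_cancel]
  refine ⟨?_, ?_, hfteq, fun s hs => (hsub hs).2.2.2, hl'.2.2.1⟩
  · refine (hf.mono (Ici_subset_Ici.2 hl'.1.le)).sub ?_
    exact (expNegInvGlue.contDiff.comp (contDiff_const.sub contDiff_id)).contDiffOn
  · intro s hs
    rcases lt_or_ge s s₀ with h | h
    · exact (hsub ⟨hs, h⟩).2.1
    · rw [hfteq s h]; exact hpos s (hs₀.le.trans h)


/-- Bending Lemma 4.5, in terms of the radial profile function: a smooth positive profile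
on `[a,∞)` satisfying the (non-strict) charged DEC inequality can be deformed on a small
interval `[s₀ - δ, s₀)` (where `f'(s₀) > 0`) so that the strict charged DEC inequality
holds there, keeping the profile unchanged on `[s₀, ∞)`. Moreover, if `f(s₀) > α > 0` and
`f''(s₀) > 0`, the deformation can be chosen with `f̃(s₀ - δ) > α` and
`f̃'(s₀ - δ) < f'(s₀)`. -/
theorem stmt_4 (n : ℕ) (hn : 2 ≤ n) (Q a : ℝ) (f : ℝ → ℝ)
    (hf : ContDiffOn ℝ (⊤ : ℕ∞) f (Set.Ici a))
    (hpos : ∀ s ∈ Set.Ici a, 0 < f s)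
    (hDEC : ∀ s ∈ Set.Ici a,
      deriv (deriv f) s ≤
        (((n : ℝ) - 1) / (2 * f s)) *
          (1 - (deriv f s) ^ 2 - Q ^ 2 / (f s) ^ (2 * (n - 1))))
    (s₀ : ℝ) (hs₀ : a < s₀) (hf' : 0 < deriv f s₀) :
    (∃ δ ∈ Set.Ioo 0 (s₀ - a), ∃ ft : ℝ → ℝ,
      ContDiffOn ℝ (⊤ : ℕ∞) ft (Set.Ici (s₀ - δ)) ∧
      (∀ s ∈ Set.Ici (s₀ - δ), 0 < ft s) ∧
      (∀ s ∈ Set.Ici s₀, ft s = f s) ∧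
      (∀ s ∈ Set.Ico (s₀ - δ) s₀,
        deriv (deriv ft) s <
          (((n : ℝ) - 1) / (2 * ft s)) *
            (1 - (deriv ft s) ^ 2 - Q ^ 2 / (ft s) ^ (2 * (n - 1))))) ∧
    (∀ α : ℝ, 0 < α → α < f s₀ → 0 < deriv (deriv f) s₀ →
      ∃ δ ∈ Set.Ioo 0 (s₀ - a), ∃ ft : ℝ → ℝ,
        ContDiffOn ℝ (⊤ : ℕ∞) ft (Set.Ici (s₀ - δ)) ∧
        (∀ s ∈ Set.Ici (s₀ - δ), 0 < ft s) ∧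
        (∀ s ∈ Set.Ici s₀, ft s = f s) ∧
        (∀ s ∈ Set.Ico (s₀ - δ) s₀,
          deriv (deriv ft) s <
            (((n : ℝ) - 1) / (2 * ft s)) *
              (1 - (deriv ft s) ^ 2 - Q ^ 2 / (ft s) ^ (2 * (n - 1)))) ∧
        α < ft (s₀ - δ) ∧ deriv ft (s₀ - δ) < deriv f s₀) := by

  constructor
  · obtain ⟨δ, hδ, ft, h1, h2, h3, h4, -⟩ := bend_core n Q a f hf hpos hDEC s₀ hs₀
      (fun _ _ => True) (fun _ _ _ _ _ _ => Eventually.of_forall fun _ => trivial)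
    exact ⟨δ, hδ, ft, h1, h2, h3, h4⟩
  · intro α _ hα hf2
    refine bend_core n Q a f hf hpos hDEC s₀ hs₀
      (fun ft s => α < ft s ∧ deriv ft s < deriv f s₀) ?_
    intro ft h0 h1 h2 hc hd
    have A : ∀ᶠ s in 𝓝 s₀, α < ft s := hc.eventually (lt_mem_nhds (by rw [h0]; exact hα))
    have hs := (hasDerivAt_iff_tendsto_slope.1 hd.hasDerivAt)
    have B : ∀ᶠ s in 𝓝[≠] s₀, 0 < slope (deriv ft) s₀ s :=
      hs.eventually (lt_mem_nhds (by rw [h2]; exact hf2))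
    filter_upwards [A.filter_mono nhdsWithin_le_nhds,
      B.filter_mono (nhdsWithin_mono _ fun x (hx : x < s₀) => hx.ne), self_mem_nhdsWithin]
      with s hA hB hlt
    refine ⟨hA, ?_⟩
    have hlt : s < s₀ := hlt
    rw [slope_def_field] at hB
    rw [← h1]
    by_contra hcon
    push Not at hcon
    exact absurd hB (not_lt.2 (div_nonpos_of_nonneg_of_nonpos (by linarith) (by linarith)))
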